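/- Let G be a polycyclic-by-finite groupoid (a groupoid such that for every object a the isotropy group G(a) is polycyclic-by-finite) and let S be a ring that is strongly G-graded and object unital. Then S is left (respectively right) noetherian if and only if G_0 is finite and for every a ∈ G_0 the ring S_a is left (respectively right) noetherian. -/

import Mathlib

open CategoryTheory

namespace ChainPaper

section NonUnital

variable {S : Type*} [NonUnitalRing S]

/-- The additive subgroup `e S f = {e * s * f | s ∈ S}` of a non-unital ring `S`. -/
def corner (e f : S) : AddSubgroup S :=
  ((AddMonoidHom.mulLeft e).comp (AddMonoidHom.mulRight f)).range

/-- The additive subgroup `S e = {s * e | s ∈ S}`. -/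
def rightMulRange (e : S) : AddSubgroup S := (AddMonoidHom.mulRight e).range

/-- The additive subgroup `e S = {e * s | s ∈ S}`. -/
def leftMulRange (e : S) : AddSubgroup S := (AddMonoidHom.mulLeft e).range

/-- The product of two additive subgroups of a ring: the additive subgroup generated by
all products `a * b` with `a ∈ A`, `b ∈ B`. -/
def sMul (A B : AddSubgroup S) : AddSubgroup S :=
  AddSubgroup.closure {x | ∃ a ∈ A, ∃ b ∈ B, x = a * b}

/-- `I` is a left ideal of the (possibly non-unital) subring whose carrier is
the additive subgroup `C` (closed under multiplication). -/
def IsLeftIdealIn (C I : AddSubgroup S) : Prop :=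
  I ≤ C ∧ ∀ s ∈ C, ∀ x ∈ I, s * x ∈ I

def IsRightIdealIn (C I : AddSubgroup S) : Prop :=
  I ≤ C ∧ ∀ s ∈ C, ∀ x ∈ I, x * s ∈ I

/-- `M` is a left `C`-submodule of `H` (both viewed inside the ambient ring `S`,
with `C` acting by left multiplication). -/
def IsLeftSubmoduleIn (C H M : AddSubgroup S) : Prop :=
  M ≤ H ∧ ∀ s ∈ C, ∀ x ∈ M, s * x ∈ M

def IsRightSubmoduleIn (C H M : AddSubgroup S) : Prop :=
  M ≤ H ∧ ∀ s ∈ C, ∀ x ∈ M, x * s ∈ M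

/-- The descending chain condition on the subcollection of additive subgroups of `S`
cut out by the predicate `P`. -/
def DCCOn (P : AddSubgroup S → Prop) : Prop :=
  ∀ f : ℕ → AddSubgroup S, (∀ n, P (f n)) → (∀ n, f (n + 1) ≤ f n) →
    ∃ n, ∀ m, n ≤ m → f m = f n

/-- The ascending chain condition on the subcollection of additive subgroups of `S`
cut out by the predicate `P`. -/
def ACCOn (P : AddSubgroup S → Prop) : Prop :=
  ∀ f : ℕ → AddSubgroup S, (∀ n, P (f n)) → (∀ n, f n ≤ f (n + 1)) →
    ∃ n, ∀ m, n ≤ m → f m = f n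

def LeftArtinianOn (C : AddSubgroup S) : Prop := DCCOn (IsLeftIdealIn C)
def RightArtinianOn (C : AddSubgroup S) : Prop := DCCOn (IsRightIdealIn C)
def LeftNoetherianOn (C : AddSubgroup S) : Prop := ACCOn (IsLeftIdealIn C)
def RightNoetherianOn (C : AddSubgroup S) : Prop := ACCOn (IsRightIdealIn C)

end NonUnital

/-- A possibly non-unital ring is left artinian if its poset of left ideals
satisfies the descending chain condition. -/
def IsLeftArtinian (S : Type*) [NonUnitalRing S] : Prop := LeftArtinianOn (⊤ : AddSubgroup S)
def IsRightArtinian (S : Type*) [NonUnitalRing S] : Prop := RightArtinianOn (⊤ : AddSubgroup S)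
def IsLeftNoetherian (S : Type*) [NonUnitalRing S] : Prop := LeftNoetherianOn (⊤ : AddSubgroup S)
def IsRightNoetherian (S : Type*) [NonUnitalRing S] : Prop := RightNoetherianOn (⊤ : AddSubgroup S)

section NonUnital2

variable {S : Type*} [NonUnitalRing S]

/-- `{e i}_{i ∈ ι}` is a complete set of idempotents for `S`: the `e i` are nonzero
pairwise orthogonal idempotents and `S = ⊕ᵢ S eᵢ = ⊕ᵢ eᵢ S` as internal direct sums of
additive subgroups. -/
structure IsCompleteIdempotents {ι : Type*} (e : ι → S) : Prop where
  ne_zero : ∀ i, e i ≠ 0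
  idem : ∀ i, e i * e i = e i
  orthogonal : ∀ i j, i ≠ j → e i * e j = 0
  indep_right : iSupIndep fun i => rightMulRange (e i)
  span_right : (⨆ i, rightMulRange (e i)) = ⊤
  indep_left : iSupIndep fun i => leftMulRange (e i)
  span_left : (⨆ i, leftMulRange (e i)) = ⊤

/-- A complete set of idempotents is strong if for all `p q`, whenever one of
`eₚ S e_q` and `e_q S eₚ` is nonzero, then the other is nonzero and `eₚ ∈ (eₚ S e_q)(e_q S eₚ)`. -/
def IsStrongIdempotents {ι : Type*} (e : ι → S) : Prop :=
  ∀ p q : ι,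
    (corner (e p) (e q) ≠ ⊥ ∨ corner (e q) (e p) ≠ ⊥) →
      corner (e p) (e q) ≠ ⊥ ∧ corner (e q) (e p) ≠ ⊥ ∧
        e p ∈ sMul (corner (e p) (e q)) (corner (e q) (e p))

/-- `H` is finitely generated as a left module over `C` (inside the ambient ring `S`,
`C` acting by left multiplication). -/
def IsFGLeftModuleIn (C H : AddSubgroup S) : Prop :=
  ∃ F : Finset S, ↑F ⊆ (H : Set S) ∧
    ∀ x ∈ H, x ∈ sInf {M : AddSubgroup S | ↑F ⊆ (M : Set S) ∧ ∀ s ∈ C, ∀ y ∈ M, s * y ∈ M}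

def IsFGRightModuleIn (C H : AddSubgroup S) : Prop :=
  ∃ F : Finset S, ↑F ⊆ (H : Set S) ∧
    ∀ x ∈ H, x ∈ sInf {M : AddSubgroup S | ↑F ⊆ (M : Set S) ∧ ∀ s ∈ C, ∀ y ∈ M, y * s ∈ M}

end NonUnital2

/-- A small category `G` is hom-set strong if for all objects `x y`, whenever one of
`G(x,y)` and `G(y,x)` is nonempty (here `G(x,y)` denotes the set of morphisms `y → x`),
then the other is nonempty and `𝟙 x ∈ G(x,y)G(y,x)`. -/
def HomSetStrong (G : Type*) [Category G] : Prop :=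
  ∀ x y : G, (Nonempty (y ⟶ x) ∨ Nonempty (x ⟶ y)) →
    Nonempty (y ⟶ x) ∧ Nonempty (x ⟶ y) ∧ ∃ (g : y ⟶ x) (h : x ⟶ y), h ≫ g = 𝟙 x

/-- An object unital grading of the (possibly non-unital) ring `S` by the small category `G`:
`S = ⊕_{g ∈ G₁} S_g` with `S_g S_h ⊆ S_{g ∘ h}` for composable morphisms, `S_g S_h = 0` for
non-composable ones, and each `S_a` (`a ∈ G₀`) is unital and nonzero with identity `one a`
acting as claimed. The component at a morphism `g : a ⟶ b` (in Mathlib's arrow direction) is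
`comp g`, and products follow the paper's convention `S_g S_h ⊆ S_{gh}` where `gh` denotes
`h ≫ g`. -/
structure ObjectUnitalGrading (G : Type*) [Category G] (S : Type*) [NonUnitalRing S] where
  comp : ∀ {a b : G}, (a ⟶ b) → AddSubgroup S
  indep : iSupIndep fun p : Σ a : G, Σ b : G, a ⟶ b => comp p.2.2
  span : (⨆ p : Σ a : G, Σ b : G, a ⟶ b, comp p.2.2) = ⊤
  mul_mem : ∀ {a b c : G} (g : b ⟶ c) (h : a ⟶ b) {x y : S},
    x ∈ comp g → y ∈ comp h → x * y ∈ comp (h ≫ g)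
  mul_eq_zero : ∀ {a b a' b' : G} (g : a ⟶ b) (h : a' ⟶ b') {x y : S},
    x ∈ comp g → y ∈ comp h → b' ≠ a → x * y = 0
  one : G → S
  one_mem : ∀ a : G, one a ∈ comp (𝟙 a)
  one_ne_zero : ∀ a : G, one a ≠ 0
  one_mul_mem : ∀ {a b : G} (g : a ⟶ b), ∀ x ∈ comp g, one b * x = x
  mul_one_mem : ∀ {a b : G} (g : a ⟶ b), ∀ x ∈ comp g, x * one a = x

namespace ObjectUnitalGrading

variable {G : Type*} [Category G] {S : Type*} [NonUnitalRing S]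

/-- `E.hom a b = S_{G(b,a)}`, the sum of the components of all morphisms `a ⟶ b`. -/
def hom (E : ObjectUnitalGrading G S) (a b : G) : AddSubgroup S :=
  ⨆ g : a ⟶ b, E.comp g

/-- The grading is strong: `S_g S_h = S_{gh}` for all composable `g, h`. -/
def IsStronglyGraded (E : ObjectUnitalGrading G S) : Prop :=
  ∀ {a b c : G} (g : b ⟶ c) (h : a ⟶ b), sMul (E.comp g) (E.comp h) = E.comp (h ≫ g)

/-- The grading is hom-set strong: for all objects `p q`, whenever one of `S_{G(p,q)}`
and `S_{G(q,p)}` is nonzero, the other is nonzero and `1_{S_p} ∈ S_{G(p,q)} S_{G(q,p)}`. -/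
def IsHomSetStronglyGraded (E : ObjectUnitalGrading G S) : Prop :=
  ∀ p q : G, (E.hom q p ≠ ⊥ ∨ E.hom p q ≠ ⊥) →
    E.hom q p ≠ ⊥ ∧ E.hom p q ≠ ⊥ ∧ E.one p ∈ sMul (E.hom q p) (E.hom p q)

end ObjectUnitalGrading

/-- A group `H` is polycyclic-by-finite if it has a finite length subnormal series with
each factor a finite group or an infinite cyclic group. -/
def IsPolycyclicByFinite (H : Type*) [Group H] : Prop :=
  ∃ (n : ℕ) (c : Fin (n + 1) → Subgroup H),
    c 0 = ⊥ ∧ c (Fin.last n) = ⊤ ∧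
      ∀ i : Fin n,
        c i.castSucc ≤ c i.succ ∧
        ∃ _ : ((c i.castSucc).subgroupOf (c i.succ)).Normal,
          Finite ((c i.succ) ⧸ (c i.castSucc).subgroupOf (c i.succ)) ∨
            (Infinite ((c i.succ) ⧸ (c i.castSucc).subgroupOf (c i.succ)) ∧
              IsCyclic ((c i.succ) ⧸ (c i.castSucc).subgroupOf (c i.succ)))

/-- Data exhibiting the non-unital ring `A` as the category algebra `T[G]`: an additive
isomorphism with the free `T`-module on the set of morphisms of `G`, matching the
multiplication `(t g)(u h) = (t u)(gh)` for composable `g, h` (where `gh = h ≫ g`) and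
`(t g)(u h) = 0` otherwise. -/
structure CategoryAlgebraIso (T : Type*) [Ring T] (G : Type*) [Category G]
    (A : Type*) [NonUnitalRing A] where
  equiv : ((Σ a : G, Σ b : G, a ⟶ b) →₀ T) ≃+ A
  mul_single_comp : ∀ {a b c : G} (g : b ⟶ c) (h : a ⟶ b) (t u : T),
    equiv (Finsupp.single ⟨b, c, g⟩ t) * equiv (Finsupp.single ⟨a, b, h⟩ u) =
      equiv (Finsupp.single ⟨a, c, h ≫ g⟩ (t * u))
  mul_single_ne : ∀ {a b a' b' : G} (g : a ⟶ b) (h : a' ⟶ b') (t u : T), b' ≠ a →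
    equiv (Finsupp.single ⟨a, b, g⟩ t) * equiv (Finsupp.single ⟨a', b', h⟩ u) = 0

/-- Data exhibiting the non-unital ring `A` as the skew category algebra `R *_α G`: an
additive isomorphism with the direct sum `⊕_{g ∈ G₁} R_{c(g)}`, matching the multiplication
`(r g)(r' h) = (r · α_g(r')) (gh)` for composable `g, h` (where `gh = h ≫ g`) and
`(r g)(r' h) = 0` otherwise. -/
structure SkewCategoryAlgebraIso (G : Type*) [Category G]
    [DecidableEq (Σ a : G, Σ b : G, a ⟶ b)]
    (R : G → Type*) [∀ a, Ring (R a)]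
    (α : ∀ ⦃a b : G⦄, (a ⟶ b) → (R a →+* R b))
    (A : Type*) [NonUnitalRing A] where
  equiv : (Π₀ p : Σ a : G, Σ b : G, a ⟶ b, R p.2.1) ≃+ A
  mul_single_comp : ∀ {a b c : G} (g : b ⟶ c) (h : a ⟶ b) (r : R c) (r' : R b),
    equiv (DFinsupp.single ⟨b, c, g⟩ r) * equiv (DFinsupp.single ⟨a, b, h⟩ r') =
      equiv (DFinsupp.single ⟨a, c, h ≫ g⟩ (r * α g r'))
  mul_single_ne : ∀ {a b a' b' : G} (g : a ⟶ b) (h : a' ⟶ b') (r : R b) (r' : R b'),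
    b' ≠ a →
      equiv (DFinsupp.single ⟨a, b, g⟩ r) * equiv (DFinsupp.single ⟨a', b', h⟩ r') = 0

section SubgroupProducts

variable {S : Type*} [NonUnitalRing S]

theorem mul_mem_sMul {A B : AddSubgroup S} {a b : S} (ha : a ∈ A) (hb : b ∈ B) :
    a * b ∈ sMul A B :=
  AddSubgroup.subset_closure ⟨a, ha, b, hb, rfl⟩

theorem sMul_le {A B N : AddSubgroup S} : sMul A B ≤ N ↔ ∀ a ∈ A, ∀ b ∈ B, a * b ∈ N := by
  refine ⟨fun h a ha b hb => h (mul_mem_sMul ha hb), fun h => ?_⟩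
  refine (AddSubgroup.closure_le _).2 ?_
  rintro _ ⟨a, ha, b, hb, rfl⟩
  exact h a ha b hb

theorem sMul_mono {A A' B B' : AddSubgroup S} (hA : A ≤ A') (hB : B ≤ B') :
    sMul A B ≤ sMul A' B' :=
  sMul_le.2 fun _ ha _ hb => mul_mem_sMul (hA ha) (hB hb)

theorem mul_mem_of_mem_sMul_left {A B N : AddSubgroup S} {u x : S} (hu : u ∈ sMul A B)
    (h : ∀ a ∈ A, ∀ b ∈ B, a * (b * x) ∈ N) : u * x ∈ N := by
  have : sMul A B ≤ N.comap (AddMonoidHom.mulRight x) :=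
    sMul_le.2 fun a ha b hb => by
      simpa [AddSubgroup.mem_comap, mul_assoc] using h a ha b hb
  exact this hu

theorem mul_mem_of_mem_sMul_right {A B N : AddSubgroup S} {u x : S} (hu : u ∈ sMul A B)
    (h : ∀ a ∈ A, ∀ b ∈ B, (x * a) * b ∈ N) : x * u ∈ N := by
  have : sMul A B ≤ N.comap (AddMonoidHom.mulLeft x) :=
    sMul_le.2 fun a ha b hb => by
      simpa [AddSubgroup.mem_comap, mul_assoc] using h a ha b hb
  exact this hu

theorem mul_mem_of_mem_iSup {ι κ : Sort*} {A : ι → AddSubgroup S} {B : κ → AddSubgroup S}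
    {N : AddSubgroup S} (h : ∀ i j, ∀ a ∈ A i, ∀ b ∈ B j, a * b ∈ N) {x y : S}
    (hx : x ∈ ⨆ i, A i) (hy : y ∈ ⨆ j, B j) : x * y ∈ N := by
  have h₁ : ∀ i, ∀ a ∈ A i, a * y ∈ N := fun i a ha => by
    have : (⨆ j, B j) ≤ N.comap (AddMonoidHom.mulLeft a) :=
      iSup_le fun j b hb => h i j a ha b hb
    exact this hy
  have : (⨆ i, A i) ≤ N.comap (AddMonoidHom.mulRight y) := iSup_le fun i a ha => h₁ i a ha
  exact this hx

theorem mul_eq_of_mem_iSup {ι : Sort*} {A : ι → AddSubgroup S} {e : S}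
    (h : ∀ i, ∀ a ∈ A i, e * a = a) {x : S} (hx : x ∈ ⨆ i, A i) : e * x = x := by
  have : (⨆ i, A i) ≤ (AddMonoidHom.mulLeft e - AddMonoidHom.id S).ker :=
    iSup_le fun i a ha => by simp [AddMonoidHom.mem_ker, h i a ha]
  simpa [AddMonoidHom.mem_ker, sub_eq_zero] using this hx

end SubgroupProducts

section ChainConditions

variable {S : Type*} [NonUnitalRing S]

theorem ACCOn.mono {P Q : AddSubgroup S → Prop} (h : ACCOn P) (hQP : ∀ M, Q M → P M) :
    ACCOn Q :=
  fun f hf hmono => h f (fun n => hQP _ (hf n)) hmono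

/-- A family of subgroups increasing in two parameters stabilizes in one of them, uniformly in
the other. -/
theorem ACCOn.exists_forall_eq {P : AddSubgroup S → Prop} (h : ACCOn P)
    (J : ℕ → ℕ → AddSubgroup S) (hP : ∀ n k, P (J n k)) (h₁ : ∀ k, Monotone fun n => J n k)
    (h₂ : ∀ n, Monotone (J n)) : ∃ K, ∀ k, K ≤ k → ∀ n, J n k = J n K := by
  obtain ⟨N, hN⟩ := h (fun n => J n n) (fun n => hP n n)
    fun n => (h₁ n n.le_succ).trans (h₂ _ n.le_succ)
  choose K hK using fun n => h (J n) (hP n) fun k => h₂ n k.le_succ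
  have hlarge : ∀ n k, N ≤ n → N ≤ k → J n k = J N N := fun n k hn hk => by
    refine le_antisymm ?_ ((h₁ N hn).trans (h₂ n hk))
    rw [← hN (max n k) (hn.trans (le_max_left _ _))]
    exact (h₁ k (le_max_left n k)).trans (h₂ _ (le_max_right n k))
  refine ⟨max N ((Finset.range N).sup K), fun k hk n => ?_⟩
  rcases le_or_gt N n with hn | hn
  · rw [hlarge n k hn ((le_max_left _ _).trans hk), hlarge n _ hn (le_max_left _ _)]
  · have hle : K n ≤ max N ((Finset.range N).sup K) :=
      (Finset.le_sup (f := K) (Finset.mem_range.2 hn)).trans (le_max_right _ _)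
    rw [hK n k (hle.trans hk), hK n _ hle]

theorem ACCOn.isLeftSubmoduleIn_sup {C X Y : AddSubgroup S} (hX : IsLeftSubmoduleIn C X X)
    (hY : IsLeftSubmoduleIn C Y Y) (h₁ : ACCOn (IsLeftSubmoduleIn C X))
    (h₂ : ACCOn (IsLeftSubmoduleIn C Y)) : ACCOn (IsLeftSubmoduleIn C (X ⊔ Y)) := by
  intro f hf hmono
  have hm := monotone_nat_of_le_succ hmono
  obtain ⟨N₁, hN₁⟩ := h₁ (fun n => f n ⊓ X)
    (fun n => ⟨inf_le_right, fun s hs x hx => ⟨(hf n).2 s hs x hx.1, hX.2 s hs x hx.2⟩⟩)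
    fun n => inf_le_inf_right _ (hmono n)
  obtain ⟨N₂, hN₂⟩ := h₂ (fun n => (f n ⊔ X) ⊓ Y)
    (fun n => ⟨inf_le_right, fun s hs x hx => ⟨by
      obtain ⟨y, hy, z, hz, rfl⟩ := AddSubgroup.mem_sup.1 hx.1
      rw [mul_add]
      exact AddSubgroup.add_mem_sup ((hf n).2 s hs y hy) (hX.2 s hs z hz), hY.2 s hs x hx.2⟩⟩)
    fun n => inf_le_inf_right _ (sup_le_sup_right (hmono n) _)
  have hsup : ∀ n, f n ⊔ X = X ⊔ (f n ⊔ X) ⊓ Y := fun n => by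
    rw [inf_comm, ← sup_inf_assoc_of_le Y (le_sup_right : X ≤ f n ⊔ X)]
    exact (inf_eq_right.2 (sup_le (hf n).1 le_sup_left)).symm
  refine ⟨max N₁ N₂, fun m hle => ?_⟩
  refine (eq_of_le_of_inf_le_of_sup_le (z := X) (hm hle) ?_ ?_).symm
  · exact ((hN₁ m ((le_max_left _ _).trans hle)).trans (hN₁ _ (le_max_left _ _)).symm).le
  · rw [hsup m, hsup (max N₁ N₂)]
    have := (hN₂ m ((le_max_right _ _).trans hle)).trans (hN₂ _ (le_max_right N₁ N₂)).symm
    exact (congrArg (X ⊔ ·) this).le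

theorem ACCOn.isLeftSubmoduleIn_iSup {ι : Type*} [Finite ι] {C : AddSubgroup S}
    {X : ι → AddSubgroup S} (hX : ∀ i, IsLeftSubmoduleIn C (X i) (X i))
    (h : ∀ i, ACCOn (IsLeftSubmoduleIn C (X i))) : ACCOn (IsLeftSubmoduleIn C (⨆ i, X i)) := by
  classical
  have := Fintype.ofFinite ι
  suffices H : ∀ s : Finset ι, IsLeftSubmoduleIn C (s.sup X) (s.sup X) ∧
      ACCOn (IsLeftSubmoduleIn C (s.sup X)) by
    simpa [Finset.sup_univ_eq_iSup] using (H Finset.univ).2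
  intro s
  induction s using Finset.induction_on with
  | empty =>
    refine ⟨⟨le_rfl, fun s _ x hx => ?_⟩, fun f hf _ => ⟨0, fun m _ => ?_⟩⟩
    · simp only [Finset.sup_empty, AddSubgroup.mem_bot] at hx ⊢
      simp [hx]
    · exact (le_bot_iff.1 (hf m).1).trans (le_bot_iff.1 (hf 0).1).symm
  | insert i s _ ih =>
    rw [Finset.sup_insert]
    refine ⟨⟨le_rfl, fun s hs x hx => ?_⟩, (h i).isLeftSubmoduleIn_sup (hX i) ih.1 ih.2⟩
    obtain ⟨y, hy, z, hz, rfl⟩ := AddSubgroup.mem_sup.1 hx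
    rw [mul_add]
    exact AddSubgroup.add_mem_sup ((hX i).2 s hs y hy) (ih.1.2 s hs z hz)

/-- Half of a Morita context: the chain condition passes from left ideals of `D` to left
`C`-submodules of the `(C, D)`-bimodule `X`. -/
theorem LeftNoetherianOn.isLeftSubmoduleIn_of_context {C D X Y : AddSubgroup S}
    (h : LeftNoetherianOn D) (hDY : ∀ d ∈ D, ∀ y ∈ Y, d * y ∈ Y)
    (hYX : ∀ y ∈ Y, ∀ x ∈ X, y * x ∈ D) (hXY : ∀ x ∈ X, ∀ y ∈ Y, x * y ∈ C)
    (hX : ∀ x ∈ X, ∃ u ∈ sMul X Y, u * x = x) : ACCOn (IsLeftSubmoduleIn C X) := by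
  intro f hf hmono
  have hm := monotone_nat_of_le_succ hmono
  obtain ⟨N, hN⟩ := h (fun n => sMul Y (f n))
    (fun n => ⟨sMul_le.2 fun y hy x hx => hYX y hy x ((hf n).1 hx), fun d hd z hz =>
      mul_mem_of_mem_sMul_right hz fun y hy x hx => mul_mem_sMul (hDY d hd y hy) hx⟩)
    fun n => sMul_mono le_rfl (hmono n)
  refine ⟨N, fun m hle => le_antisymm (fun x hx => ?_) (hm hle)⟩
  obtain ⟨u, hu, hux⟩ := hX x ((hf m).1 hx)
  rw [← hux]
  refine mul_mem_of_mem_sMul_left hu fun a ha b hb => ?_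
  have hbx : b * x ∈ sMul Y (f N) := hN m hle ▸ mul_mem_sMul hb hx
  exact mul_mem_of_mem_sMul_right hbx fun y hy z hz => (hf N).2 _ (hXY a ha y hy) z hz

end ChainConditions

section GroupGraded

variable {S : Type*} [NonUnitalRing S]

theorem LeftNoetherianOn.iSup_of_finite {Q : Type*} [Group Q] [Finite Q] {B : Q → AddSubgroup S}
    (hmul : ∀ p q, ∀ x ∈ B p, ∀ y ∈ B q, x * y ∈ B (p * q)) {e : S}
    (he : ∀ q, e ∈ sMul (B q) (B q⁻¹)) (hone : ∀ q, ∀ x ∈ B q, e * x = x)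
    (h : LeftNoetherianOn (B 1)) : LeftNoetherianOn (⨆ q, B q) := by
  have hB : ACCOn (IsLeftSubmoduleIn (B 1) (⨆ q, B q)) := by
    refine ACCOn.isLeftSubmoduleIn_iSup
      (fun q => ⟨le_rfl, fun s hs x hx => by simpa using hmul 1 q s hs x hx⟩) fun q => ?_
    refine h.isLeftSubmoduleIn_of_context (Y := B q⁻¹) (fun d hd y hy => ?_) (fun y hy x hx => ?_)
      (fun x hx y hy => ?_) fun x hx => ⟨e, he q, hone q x hx⟩
    · simpa using hmul _ _ d hd y hy
    · simpa using hmul _ _ y hy x hx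
    · simpa using hmul _ _ x hx y hy
  exact hB.mono fun M hM => ⟨hM.1, fun s hs => hM.2 s (le_iSup B 1 hs)⟩

/-- The sum of the components of degrees `0, …, n - 1`. -/
def lowDegree (B : ℤ → AddSubgroup S) : ℕ → AddSubgroup S
  | 0 => ⊥
  | n + 1 => lowDegree B n ⊔ B n

/-- The possible degree `n` terms of elements of `I` of degrees `0, …, n`. -/
def leadingTerms (B : ℤ → AddSubgroup S) (n : ℕ) (I : AddSubgroup S) : AddSubgroup S :=
  B n ⊓ ((I ⊓ lowDegree B (n + 1)) ⊔ lowDegree B n)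

theorem lowDegree_mono (B : ℤ → AddSubgroup S) : Monotone (lowDegree B) :=
  monotone_nat_of_le_succ fun _ => le_sup_left

theorem leadingTerms_mono (B : ℤ → AddSubgroup S) (n : ℕ) : Monotone (leadingTerms B n) :=
  fun _ _ h => inf_le_inf_left _ (sup_le_sup_right (inf_le_inf_right _ h) _)

variable {B : ℤ → AddSubgroup S}

theorem mul_mem_lowDegree (hmul : ∀ i j, ∀ x ∈ B i, ∀ y ∈ B j, x * y ∈ B (i + j)) (k n : ℕ)
    {x y : S} (hx : x ∈ B k) (hy : y ∈ lowDegree B n) : x * y ∈ lowDegree B (n + k) := by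
  induction n generalizing y with
  | zero =>
    obtain rfl : y = 0 := hy
    simp
  | succ n ih =>
    obtain ⟨z, hz, w, hw, rfl⟩ := AddSubgroup.mem_sup.1 hy
    rw [mul_add, Nat.succ_add]
    refine AddSubgroup.add_mem_sup (ih hz) ?_
    have := hmul _ _ x hx w hw
    rwa [add_comm, ← Nat.cast_add] at this

theorem mul_mem_leadingTerms (hmul : ∀ i j, ∀ x ∈ B i, ∀ y ∈ B j, x * y ∈ B (i + j)) (k n : ℕ)
    {I : AddSubgroup S} (hI : ∀ x ∈ B k, ∀ y ∈ I, x * y ∈ I) {x y : S} (hx : x ∈ B k)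
    (hy : y ∈ leadingTerms B n I) : x * y ∈ leadingTerms B (n + k) I := by
  obtain ⟨hy₁, hy₂⟩ := hy
  refine ⟨?_, ?_⟩
  · have := hmul _ _ x hx y hy₁
    rwa [add_comm, ← Nat.cast_add] at this
  · obtain ⟨z, hz, w, hw, rfl⟩ := AddSubgroup.mem_sup.1 hy₂
    rw [mul_add]
    refine AddSubgroup.add_mem_sup ⟨hI x hx z hz.1, ?_⟩ (mul_mem_lowDegree hmul k n hx hw)
    have := mul_mem_lowDegree hmul k (n + 1) hx hz.2
    rwa [Nat.add_right_comm] at this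

theorem inf_lowDegree_le_of_leadingTerms_le {I I' : AddSubgroup S} (hle : I ≤ I')
    (h : ∀ n, leadingTerms B n I' ≤ leadingTerms B n I) (n : ℕ) : I' ⊓ lowDegree B n ≤ I := by
  induction n with
  | zero => exact inf_le_right.trans bot_le
  | succ n ih =>
    rintro x ⟨hxI, hx⟩
    obtain ⟨q, hq, p, hp, rfl⟩ := AddSubgroup.mem_sup.1 hx
    have hp' : p ∈ leadingTerms B n I' := by
      refine ⟨hp, ?_⟩
      have := AddSubgroup.add_mem_sup (T := lowDegree B n)
        (show q + p ∈ I' ⊓ lowDegree B (n + 1) from ⟨hxI, hx⟩) (neg_mem hq)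
      simpa [add_comm q p] using this
    obtain ⟨i, hi, r, hr, hir⟩ := AddSubgroup.mem_sup.1 (h n hp').2
    have hqr : q + r ∈ I := by
      refine ih ⟨?_, add_mem hq hr⟩
      have hsub : q + p - i ∈ I' := sub_mem hxI (hle hi.1)
      rwa [← hir, show q + (i + r) - i = q + r by abel] at hsub
    have hadd : q + r + i ∈ I := add_mem hqr hi.1
    rwa [show q + r + i = q + p by rw [← hir]; abel] at hadd

theorem exists_mul_mem_lowDegree (hmul : ∀ i j, ∀ x ∈ B i, ∀ y ∈ B j, x * y ∈ B (i + j))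
    {x : S} (hx : x ∈ ⨆ i, B i) :
    ∃ m₀ : ℕ, ∀ m : ℕ, m₀ ≤ m → ∃ n, ∀ y ∈ B m, y * x ∈ lowDegree B n := by
  refine AddSubgroup.iSup_induction B (C := fun x =>
    ∃ m₀ : ℕ, ∀ m : ℕ, m₀ ≤ m → ∃ n, ∀ y ∈ B m, y * x ∈ lowDegree B n) hx ?_ ?_ ?_
  · intro i x hx
    refine ⟨(-i).toNat, fun m hm => ⟨((m : ℤ) + i).toNat + 1, fun y hy => ?_⟩⟩
    refine AddSubgroup.mem_sup_right ?_
    rw [Int.toNat_of_nonneg (by omega)]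
    exact hmul _ _ y hy x hx
  · exact ⟨0, fun m _ => ⟨0, fun y _ => by simp⟩⟩
  · rintro x y ⟨a, ha⟩ ⟨b, hb⟩
    refine ⟨max a b, fun m hm => ?_⟩
    obtain ⟨k, hk⟩ := ha m ((le_max_left _ _).trans hm)
    obtain ⟨l, hl⟩ := hb m ((le_max_right _ _).trans hm)
    refine ⟨max k l, fun z hz => ?_⟩
    rw [mul_add]
    exact add_mem (lowDegree_mono B (le_max_left k l) (hk z hz))
      (lowDegree_mono B (le_max_right k l) (hl z hz))

/-- The Hilbert basis theorem for strongly `ℤ`-graded rings. -/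
theorem LeftNoetherianOn.iSup_of_int
    (hmul : ∀ i j, ∀ x ∈ B i, ∀ y ∈ B j, x * y ∈ B (i + j)) {e : S}
    (he : ∀ i, e ∈ sMul (B i) (B (-i))) (hone : ∀ i, ∀ x ∈ B i, e * x = x)
    (h : LeftNoetherianOn (B 0)) : LeftNoetherianOn (⨆ i, B i) := by
  intro f hf hmono
  have hm := monotone_nat_of_le_succ hmono
  have hclosed : ∀ k i, ∀ x ∈ B i, ∀ y ∈ f k, x * y ∈ f k :=
    fun k i x hx => (hf k).2 x (le_iSup B i hx)
  obtain ⟨K, hK⟩ := h.exists_forall_eq (fun n k => sMul (B (-n)) (leadingTerms B n (f k)))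
    (fun n k => ⟨sMul_le.2 fun b hb q hq => by simpa using hmul _ _ b hb q hq.1,
      fun s hs z hz => mul_mem_of_mem_sMul_right hz fun b hb q hq =>
        mul_mem_sMul (by simpa using hmul _ _ s hs b hb) hq⟩)
    (fun k => monotone_nat_of_le_succ fun n => sMul_le.2 fun b hb q hq => by
      rw [← hone n q hq.1, ← mul_assoc]
      have he' := he (-1)
      rw [neg_neg] at he'
      have hbe : b * e ∈ sMul (B (-(n + 1 : ℕ))) (B 1) :=
        mul_mem_of_mem_sMul_right he' fun u hu v hv => by
          refine mul_mem_sMul ?_ hv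
          have := hmul _ _ b hb u hu
          rwa [← neg_add, ← Nat.cast_succ] at this
      refine mul_mem_of_mem_sMul_left hbe fun u hu v hv => mul_mem_sMul hu ?_
      have hv' : v ∈ B (1 : ℕ) := by simpa using hv
      exact mul_mem_leadingTerms hmul 1 n (hclosed k _) hv' hq)
    (fun n k l hkl => sMul_mono le_rfl (leadingTerms_mono B n (hm hkl)))
  refine ⟨K, fun k hk => le_antisymm (fun x hx => ?_) (hm hk)⟩
  have hlead : ∀ n, leadingTerms B n (f k) ≤ leadingTerms B n (f K) := fun n p hp => by
    rw [← hone n p hp.1]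
    refine mul_mem_of_mem_sMul_left (he n) fun a ha b hb => ?_
    have hbp : b * p ∈ sMul (B (-n)) (leadingTerms B n (f K)) := by
      rw [← hK k hk n]
      exact mul_mem_sMul hb hp
    refine mul_mem_of_mem_sMul_right hbp fun b hb q hq => ?_
    have hab : a * b ∈ B (0 : ℕ) := by simpa using hmul _ _ a ha b hb
    exact mul_mem_leadingTerms hmul 0 n (hclosed K _) hab hq
  obtain ⟨m, hxm⟩ := exists_mul_mem_lowDegree hmul ((hf k).1 hx)
  obtain ⟨n, hn⟩ := hxm m le_rfl
  rw [← mul_eq_of_mem_iSup hone ((hf k).1 hx)]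
  have he' := he (-m)
  rw [neg_neg] at he'
  refine mul_mem_of_mem_sMul_left he' fun a ha b hb => hclosed K _ a ha _ ?_
  exact inf_lowDegree_le_of_leadingTerms_le (hm hk) hlead n ⟨hclosed k _ b hb x hx, hn b hb⟩

theorem LeftNoetherianOn.iSup_of_isCyclic {Q : Type*} [Group Q] [IsCyclic Q]
    {B : Q → AddSubgroup S}
    (hmul : ∀ p q, ∀ x ∈ B p, ∀ y ∈ B q, x * y ∈ B (p * q)) {e : S}
    (he : ∀ q, e ∈ sMul (B q) (B q⁻¹)) (hone : ∀ q, ∀ x ∈ B q, e * x = x)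
    (h : LeftNoetherianOn (B 1)) : LeftNoetherianOn (⨆ q, B q) := by
  obtain ⟨t, ht⟩ := IsCyclic.exists_zpow_surjective (G := Q)
  have := LeftNoetherianOn.iSup_of_int (B := fun i : ℤ => B (t ^ i)) (e := e)
    (fun i j x hx y hy => by rw [zpow_add]; exact hmul _ _ x hx y hy)
    (fun i => by rw [zpow_neg]; exact he _) (fun i => hone _) (by simpa using h)
  rwa [ht.iSup_comp] at this

end GroupGraded

namespace ObjectUnitalGrading

variable {G : Type*} {S : Type*} [NonUnitalRing S]

section Category

variable [Category G]

theorem finite_of_isLeftNoetherian (E : ObjectUnitalGrading G S) (h : IsLeftNoetherian S) :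
    Finite G := by
  by_contra hG
  rw [not_finite_iff_infinite] at hG
  let a := Infinite.natEmbedding G
  let I : ℕ → AddSubgroup S := fun n => ⨅ i : {i // n ≤ i},
    (AddMonoidHom.mulRight (E.one (a i))).ker
  have hI : ∀ n x, x ∈ I n ↔ ∀ i, n ≤ i → x * E.one (a i) = 0 := fun n x => by
    simp [I, AddSubgroup.mem_iInf, AddMonoidHom.mem_ker]
  obtain ⟨n, hn⟩ := h I
    (fun n => ⟨le_top, fun s _ x hx => (hI n _).2 fun i hi => by
      rw [mul_assoc, (hI n x).1 hx i hi, mul_zero]⟩)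
    (fun n x hx => (hI _ x).2 fun i hi => (hI n x).1 hx i (n.le_succ.trans hi))
  have hmem : E.one (a n) ∈ I (n + 1) := (hI _ _).2 fun i hi =>
    E.mul_eq_zero _ _ (E.one_mem _) (E.one_mem _) (a.injective.ne (by omega))
  rw [hn (n + 1) n.le_succ] at hmem
  refine E.one_ne_zero (a n) ?_
  rw [← E.one_mul_mem _ _ (E.one_mem (a n))]
  exact (hI _ _).1 hmem n le_rfl

variable (E : ObjectUnitalGrading G S)

theorem leftNoetherianOn_comp_id (h : IsLeftNoetherian S) (a : G) :
    LeftNoetherianOn (E.comp (𝟙 a)) := by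
  intro f hf hmono
  have hm := monotone_nat_of_le_succ hmono
  obtain ⟨N, hN⟩ := h (fun n => sMul ⊤ (f n))
    (fun n => ⟨le_top, fun s _ z hz => mul_mem_of_mem_sMul_right hz fun b _ x hx =>
      mul_mem_sMul (AddSubgroup.mem_top _) hx⟩)
    (fun n => sMul_mono le_rfl (hmono n))
  refine ⟨N, fun m hle => le_antisymm (fun x hx => ?_) (hm hle)⟩
  let p₀ : Σ a : G, Σ b : G, a ⟶ b := ⟨a, a, 𝟙 a⟩
  let R : AddSubgroup S := ⨆ (p : Σ a : G, Σ b : G, a ⟶ b) (_ : p ≠ p₀), E.comp p.2.2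
  have hR : sMul ⊤ (f N) ≤ f N ⊔ R := sMul_le.2 fun s _ y hy => by
    have hs : s ∈ ⨆ p : Σ a : G, Σ b : G, a ⟶ b, E.comp p.2.2 := E.span ▸ AddSubgroup.mem_top s
    refine mul_mem_of_mem_iSup (B := fun _ : Unit => AddSubgroup.zmultiples y) ?_ hs
      (AddSubgroup.mem_iSup_of_mem () (AddSubgroup.mem_zmultiples y))
    rintro ⟨c, b, g⟩ _ s hs _ ⟨k, rfl⟩
    simp only [mul_smul_comm]
    refine zsmul_mem ?_ k
    by_cases hp : (⟨c, b, g⟩ : Σ a : G, Σ b : G, a ⟶ b) = p₀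
    · obtain ⟨rfl, hp⟩ := Sigma.mk.inj_iff.1 hp
      obtain ⟨rfl, hp⟩ := Sigma.mk.inj_iff.1 (eq_of_heq hp)
      obtain rfl := eq_of_heq hp
      exact AddSubgroup.mem_sup_left ((hf N).2 s hs y hy)
    · by_cases hc : a = c
      · subst hc
        refine AddSubgroup.mem_sup_right ?_
        have hsy := E.mul_mem g (𝟙 a) hs ((hf N).1 hy)
        rw [Category.id_comp] at hsy
        exact AddSubgroup.mem_iSup_of_mem _ (AddSubgroup.mem_iSup_of_mem hp hsy)
      · rw [E.mul_eq_zero g (𝟙 a) hs ((hf N).1 hy) hc]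
        exact zero_mem _
  have hxC := (hf m).1 hx
  have hx' : x ∈ sMul ⊤ (f N) := by
    rw [← hN m hle, ← E.one_mul_mem _ x hxC]
    exact mul_mem_sMul (AddSubgroup.mem_top _) hx
  obtain ⟨i, hi, r, hr, rfl⟩ := AddSubgroup.mem_sup.1 (hR hx')
  have hrC : r ∈ E.comp (𝟙 a) := by simpa using sub_mem hxC ((hf N).1 hi)
  have hr0 : r = 0 := AddSubgroup.disjoint_def.1 (E.indep p₀) hrC hr
  simpa [hr0] using hi

theorem mul_mem_hom {a b c : G} {x y : S} (hx : x ∈ E.hom b c) (hy : y ∈ E.hom a b) :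
    x * y ∈ E.hom a c :=
  mul_mem_of_mem_iSup (fun g h _ ha _ hb =>
    AddSubgroup.mem_iSup_of_mem (S := fun g : a ⟶ c => E.comp g) (h ≫ g) (E.mul_mem g h ha hb))
    hx hy

/-- The sum of the components of the endomorphisms in `T`. -/
def part {a : G} (T : Set (End a)) : AddSubgroup S :=
  ⨆ g : T, E.comp (g : End a)

variable {E} in
theorem comp_le_part {a : G} {T : Set (End a)} {g : End a} (hg : g ∈ T) :
    E.comp g ≤ E.part T :=
  le_iSup (fun g : T => E.comp (g : End a)) ⟨g, hg⟩

theorem mul_mem_part {a : G} {T U V : Set (End a)} (h : ∀ g ∈ T, ∀ k ∈ U, g * k ∈ V) {x y : S}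
    (hx : x ∈ E.part T) (hy : y ∈ E.part U) : x * y ∈ E.part V :=
  mul_mem_of_mem_iSup (fun g k _ ha _ hb =>
    comp_le_part (h _ g.2 _ k.2) (E.mul_mem _ _ ha hb)) hx hy

theorem part_univ (a : G) : E.part (Set.univ : Set (End a)) = E.hom a a :=
  le_antisymm (iSup_le fun g => le_iSup (fun g : a ⟶ a => E.comp g) g.1)
    (iSup_le fun g => comp_le_part (g := g) (Set.mem_univ _))

theorem part_singleton_one (a : G) : E.part ({1} : Set (End a)) = E.comp (𝟙 a) := by
  refine le_antisymm (iSup_le ?_) (comp_le_part (g := (1 : End a)) rfl)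
  rintro ⟨_, rfl⟩
  exact le_rfl

end Category

variable [Groupoid G] (E : ObjectUnitalGrading G S)

theorem IsStronglyGraded.one_mem_sMul {E : ObjectUnitalGrading G S} (hE : E.IsStronglyGraded)
    {a b : G} (g : a ⟶ b) : E.one b ∈ sMul (E.comp g) (E.comp (Groupoid.inv g)) := by
  rw [hE g (Groupoid.inv g), Groupoid.inv_comp]
  exact E.one_mem b

theorem leftNoetherianOn_part_of_normal (hE : E.IsStronglyGraded) {a : G}
    {H K : Subgroup (End a)} (hHK : H ≤ K) [(H.subgroupOf K).Normal]
    (hQ : Finite (K ⧸ H.subgroupOf K) ∨ IsCyclic (K ⧸ H.subgroupOf K))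
    (h : LeftNoetherianOn (E.part (H : Set (End a)))) :
    LeftNoetherianOn (E.part (K : Set (End a))) := by
  let coset : K ⧸ H.subgroupOf K → Set (End a) := fun q =>
    {g | ∃ hg : g ∈ K, ((⟨g, hg⟩ : K) : K ⧸ H.subgroupOf K) = q}
  have hmul : ∀ p q, ∀ x ∈ E.part (coset p), ∀ y ∈ E.part (coset q),
      x * y ∈ E.part (coset (p * q)) := fun p q x hx y hy => by
    refine E.mul_mem_part ?_ hx hy
    rintro g ⟨hg, rfl⟩ k ⟨hk, rfl⟩
    exact ⟨MulMemClass.mul_mem hg hk, rfl⟩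
  have he : ∀ q, E.one a ∈ sMul (E.part (coset q)) (E.part (coset q⁻¹)) := fun q => by
    obtain ⟨⟨g, hg⟩, rfl⟩ := QuotientGroup.mk_surjective q
    exact sMul_mono (comp_le_part (T := coset _) ⟨hg, rfl⟩)
      (comp_le_part (T := coset _) (g := g⁻¹) ⟨inv_mem hg, rfl⟩)
      (hE.one_mem_sMul g)
  have hone : ∀ q, ∀ x ∈ E.part (coset q), E.one a * x = x := fun q x hx =>
    mul_eq_of_mem_iSup (fun g y hy => E.one_mul_mem _ y hy) hx
  have hcoset : coset 1 = (H : Set (End a)) := by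
    ext g
    refine ⟨fun ⟨hg, hq⟩ => ?_, fun hg => ⟨hHK hg, ?_⟩⟩
    · exact Subgroup.mem_subgroupOf.1 ((QuotientGroup.eq_one_iff _).1 hq)
    · exact (QuotientGroup.eq_one_iff _).2 (Subgroup.mem_subgroupOf.2 hg)
  have hsup : ⨆ q, E.part (coset q) = E.part (K : Set (End a)) :=
    le_antisymm (iSup_le fun q => iSup_le fun g => comp_le_part g.2.1)
      (iSup_le fun g => (comp_le_part (T := coset _) ⟨g.2, rfl⟩).trans
        (le_iSup (fun q => E.part (coset q)) ((⟨g.1, g.2⟩ : K) : K ⧸ H.subgroupOf K)))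
  rw [← hsup]
  rw [← hcoset] at h
  rcases hQ with hQ | hQ
  · exact LeftNoetherianOn.iSup_of_finite hmul he hone h
  · exact LeftNoetherianOn.iSup_of_isCyclic hmul he hone h

theorem leftNoetherianOn_hom_self (hE : E.IsStronglyGraded) {a : G}
    (hpc : IsPolycyclicByFinite (End a)) (h : LeftNoetherianOn (E.comp (𝟙 a))) :
    LeftNoetherianOn (E.hom a a) := by
  obtain ⟨n, c, h0, hlast, hstep⟩ := hpc
  suffices H : ∀ i, LeftNoetherianOn (E.part (c i : Set (End a))) by
    have := H (Fin.last n)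
    rwa [hlast, Subgroup.coe_top, part_univ] at this
  intro i
  induction i using Fin.induction with
  | zero => rwa [h0, Subgroup.coe_bot, part_singleton_one]
  | succ i ih =>
    obtain ⟨hle, hnormal, hQ⟩ := hstep i
    exact E.leftNoetherianOn_part_of_normal hE hle (hQ.imp_right And.right) ih

theorem isLeftNoetherian_of_hom_self [Finite G] (hE : E.IsStronglyGraded)
    (h : ∀ a, LeftNoetherianOn (E.hom a a)) : IsLeftNoetherian S := by
  classical
  have := Fintype.ofFinite G
  let X : G → AddSubgroup S := fun b => ⨆ a, E.hom b a
  have hX : ⨆ b, X b = ⊤ := by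
    rw [eq_top_iff, ← E.span]
    refine iSup_le fun p => le_trans ?_ (le_iSup X p.1)
    exact le_trans (le_iSup (fun g : p.1 ⟶ p.2.1 => E.comp g) p.2.2)
      (le_iSup (fun a => E.hom p.1 a) p.2.1)
  have hhom : ∀ {a b a' b' : G} {x y : S}, x ∈ E.hom a b → y ∈ E.hom a' b' → b' ≠ a →
      x * y = 0 := fun hx hy hne =>
    AddSubgroup.mem_bot.1 (mul_mem_of_mem_iSup
      (fun g h x hx y hy => AddSubgroup.mem_bot.2 (E.mul_eq_zero g h hx hy hne)) hx hy)
  have hsmul : ∀ b, ∀ s ∈ (⊤ : AddSubgroup S), ∀ x ∈ X b, s * x ∈ X b := fun b s _ x hx => by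
    have hs : s ∈ ⨆ p : Σ a : G, Σ b : G, a ⟶ b, E.comp p.2.2 := E.span ▸ AddSubgroup.mem_top s
    refine mul_mem_of_mem_iSup ?_ hs hx
    rintro ⟨c, d, g⟩ a s hs x hx
    have hs' : s ∈ E.hom c d := AddSubgroup.mem_iSup_of_mem (S := fun g : c ⟶ d => E.comp g) g hs
    by_cases hac : a = c
    · subst hac
      exact AddSubgroup.mem_iSup_of_mem d (E.mul_mem_hom hs' hx)
    · rw [hhom hs' hx hac]
      exact zero_mem _
  have hacc : ACCOn (IsLeftSubmoduleIn ⊤ (⨆ b, X b)) := by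
    refine ACCOn.isLeftSubmoduleIn_iSup (fun b => ⟨le_rfl, hsmul b⟩) fun b => ?_
    refine (h b).isLeftSubmoduleIn_of_context (Y := ⨆ a, E.hom a b) (fun d hd y hy => ?_)
      (fun y hy x hx => ?_) (fun _ _ _ _ => AddSubgroup.mem_top _) fun x hx => ?_
    · exact mul_mem_of_mem_iSup (A := fun _ : Unit => E.hom b b)
        (fun _ a d hd y hy => AddSubgroup.mem_iSup_of_mem a (E.mul_mem_hom hd hy))
        (AddSubgroup.mem_iSup_of_mem () hd) hy
    · refine mul_mem_of_mem_iSup (fun a c y hy x hx => ?_) hy hx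
      by_cases hca : c = a
      · subst hca
        exact E.mul_mem_hom hy hx
      · rw [hhom hy hx hca]
        exact zero_mem _
    · refine ⟨∑ a with Nonempty (b ⟶ a), E.one a, sum_mem fun a ha => ?_, ?_⟩
      · obtain ⟨g⟩ := (Finset.mem_filter.1 ha).2
        refine sMul_mono ?_ ?_ (hE.one_mem_sMul g)
        · exact (le_iSup (fun g : b ⟶ a => E.comp g) g).trans (le_iSup (fun a => E.hom b a) a)
        · exact (le_iSup (fun g : a ⟶ b => E.comp g) (Groupoid.inv g)).trans
            (le_iSup (fun a => E.hom a b) a)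
      · refine mul_eq_of_mem_iSup (fun a y hy => mul_eq_of_mem_iSup (fun g z hz => ?_) hy) hx
        rw [Finset.sum_mul, Finset.sum_eq_single a]
        · exact E.one_mul_mem g z hz
        · exact fun c _ hc => E.mul_eq_zero (𝟙 c) g (E.one_mem c) hz hc.symm
        · exact fun ha => absurd (Finset.mem_filter.2 ⟨Finset.mem_univ a, ⟨g⟩⟩) ha
  rw [hX] at hacc
  exact hacc

theorem isLeftNoetherian_iff (hpc : ∀ a : G, IsPolycyclicByFinite (End a))
    (hE : E.IsStronglyGraded) :
    IsLeftNoetherian S ↔ Finite G ∧ ∀ a : G, LeftNoetherianOn (E.comp (𝟙 a)) :=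
  ⟨fun h => ⟨E.finite_of_isLeftNoetherian h, E.leftNoetherianOn_comp_id h⟩,
    fun ⟨_, h⟩ => E.isLeftNoetherian_of_hom_self hE fun a =>
      E.leftNoetherianOn_hom_self hE (hpc a) (h a)⟩

end ObjectUnitalGrading

section Opposite

open MulOpposite

variable {S : Type*} [NonUnitalRing S]

/-- Additive subgroups of a ring, viewed as additive subgroups of the opposite ring. -/
def opSubgroup : AddSubgroup S ≃o AddSubgroup Sᵐᵒᵖ :=
  (opAddEquiv : S ≃+ Sᵐᵒᵖ).mapAddSubgroup

theorem mem_opSubgroup {A : AddSubgroup S} {x : Sᵐᵒᵖ} : x ∈ opSubgroup A ↔ unop x ∈ A := by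
  refine ⟨?_, fun h => ⟨unop x, h, rfl⟩⟩
  rintro ⟨y, hy, rfl⟩
  exact hy

theorem sMul_opSubgroup (A B : AddSubgroup S) :
    sMul (opSubgroup A) (opSubgroup B) = opSubgroup (sMul B A) := by
  refine le_antisymm (sMul_le.2 fun a ha b hb => ?_) ?_
  · exact mem_opSubgroup.2 (mul_mem_sMul (mem_opSubgroup.1 hb) (mem_opSubgroup.1 ha))
  · rw [← OrderIso.le_symm_apply]
    refine sMul_le.2 fun b hb a ha => ?_
    rw [← unop_op (b * a), ← mem_opSubgroup, OrderIso.apply_symm_apply, op_mul]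
    exact mul_mem_sMul (mem_opSubgroup.2 ha) (mem_opSubgroup.2 hb)

theorem isLeftIdealIn_opSubgroup {C I : AddSubgroup S} :
    IsLeftIdealIn (opSubgroup C) (opSubgroup I) ↔ IsRightIdealIn C I := by
  refine and_congr opSubgroup.le_iff_le ⟨fun h s hs x hx => ?_, fun h s hs x hx => ?_⟩
  · exact mem_opSubgroup.1 (h (op s) (mem_opSubgroup.2 hs) (op x) (mem_opSubgroup.2 hx))
  · exact mem_opSubgroup.2 (h _ (mem_opSubgroup.1 hs) _ (mem_opSubgroup.1 hx))

theorem leftNoetherianOn_opSubgroup {C : AddSubgroup S} :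
    LeftNoetherianOn (opSubgroup C) ↔ RightNoetherianOn C := by
  constructor
  · intro h f hf hmono
    obtain ⟨n, hn⟩ := h (fun n => opSubgroup (f n)) (fun n => isLeftIdealIn_opSubgroup.2 (hf n))
      fun n => opSubgroup.monotone (hmono n)
    exact ⟨n, fun m hm => opSubgroup.injective (hn m hm)⟩
  · intro h f hf hmono
    obtain ⟨n, hn⟩ := h (fun n => opSubgroup.symm (f n))
      (fun n => isLeftIdealIn_opSubgroup.1 (by simpa using hf n))
      fun n => opSubgroup.symm.monotone (hmono n)
    exact ⟨n, fun m hm => opSubgroup.symm.injective (hn m hm)⟩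

theorem isLeftNoetherian_mulOpposite : IsLeftNoetherian Sᵐᵒᵖ ↔ IsRightNoetherian S := by
  refine Iff.trans ?_ (leftNoetherianOn_opSubgroup (C := (⊤ : AddSubgroup S)))
  rw [map_top]
  rfl

variable {G : Type*} [Groupoid G]

/-- The grading of the opposite ring in which the component at `g` is the original component
at `g⁻¹`. -/
def ObjectUnitalGrading.opposite (E : ObjectUnitalGrading G S) :
    ObjectUnitalGrading G Sᵐᵒᵖ where
  comp g := opSubgroup (E.comp (Groupoid.inv g))
  indep := by
    have hinj : Function.Injective
        fun p : Σ a : G, Σ b : G, a ⟶ b =>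
          (⟨p.2.1, p.1, Groupoid.inv p.2.2⟩ : Σ a : G, Σ b : G, a ⟶ b) :=
      Function.LeftInverse.injective
        (g := fun p => ⟨p.2.1, p.1, Groupoid.inv p.2.2⟩) fun p => by simp
    exact (E.indep.comp hinj).map_orderIso opSubgroup
  span := by
    have hsurj : Function.Surjective
        fun p : Σ a : G, Σ b : G, a ⟶ b =>
          (⟨p.2.1, p.1, Groupoid.inv p.2.2⟩ : Σ a : G, Σ b : G, a ⟶ b) :=
      fun p => ⟨⟨p.2.1, p.1, Groupoid.inv p.2.2⟩, by simp⟩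
    rw [← OrderIso.map_iSup, map_eq_top_iff, ← E.span]
    exact hsurj.iSup_comp (g := fun p : Σ a : G, Σ b : G, a ⟶ b => E.comp p.2.2)
  mul_mem g h x y hx hy := by
    rw [mem_opSubgroup] at hx hy ⊢
    have := E.mul_mem _ _ hy hx
    simpa using this
  mul_eq_zero g h x y hx hy hne := by
    rw [mem_opSubgroup] at hx hy
    exact unop_injective (E.mul_eq_zero _ _ hy hx hne.symm)
  one a := op (E.one a)
  one_mem a := by
    rw [mem_opSubgroup]
    simpa using E.one_mem a
  one_ne_zero a := by simpa using E.one_ne_zero a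
  one_mul_mem g x hx := unop_injective (E.mul_one_mem _ _ (mem_opSubgroup.1 hx))
  mul_one_mem g x hx := unop_injective (E.one_mul_mem _ _ (mem_opSubgroup.1 hx))

theorem ObjectUnitalGrading.opposite_comp (E : ObjectUnitalGrading G S) {a b : G} (g : a ⟶ b) :
    E.opposite.comp g = opSubgroup (E.comp (Groupoid.inv g)) :=
  rfl

theorem ObjectUnitalGrading.IsStronglyGraded.opposite {E : ObjectUnitalGrading G S}
    (hE : E.IsStronglyGraded) : E.opposite.IsStronglyGraded := by
  intro a b c g h
  rw [opposite_comp, opposite_comp, opposite_comp, sMul_opSubgroup, hE]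
  simp

theorem ObjectUnitalGrading.isRightNoetherian_iff (E : ObjectUnitalGrading G S)
    (hpc : ∀ a : G, IsPolycyclicByFinite (End a)) (hE : E.IsStronglyGraded) :
    IsRightNoetherian S ↔ Finite G ∧ ∀ a : G, RightNoetherianOn (E.comp (𝟙 a)) := by
  rw [← isLeftNoetherian_mulOpposite, E.opposite.isLeftNoetherian_iff hpc hE.opposite]
  refine and_congr_right fun _ => forall_congr' fun a => ?_
  rw [opposite_comp, leftNoetherianOn_opSubgroup]
  simp

end Opposite

theorem statement_16 {G : Type*} [Groupoid G]
    (hpc : ∀ a : G, IsPolycyclicByFinite (CategoryTheory.End a))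
    {S : Type*} [NonUnitalRing S] (E : ObjectUnitalGrading G S) (hE : E.IsStronglyGraded) :
    (IsLeftNoetherian S ↔ (Finite G ∧ ∀ a : G, LeftNoetherianOn (E.comp (𝟙 a)))) ∧
    (IsRightNoetherian S ↔ (Finite G ∧ ∀ a : G, RightNoetherianOn (E.comp (𝟙 a)))) :=
  ⟨E.isLeftNoetherian_iff hpc hE, E.isRightNoetherian_iff hpc hE⟩

end ChainPaper
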